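/- (Double crossing of a solid strand around the thick strand, solid on the left.) In R_{m+1}(Q̄_{C̃}), for every i ∈ I: (ψ_1 ψ_2 ⋯ ψ_m)(ψ_m ψ_{m−1} ⋯ ψ_1) E_a = Σ_{d_1+d_2 = λ_k^{(i)}, d_1,d_2 ≥ 0} (−1)^{d_2} x_1^{d_1} E_{d_2}^{(i)}[2,…,m+1] E_a, where E_{d}^{(i)}[2,…,m+1] denotes the d-th elementary symmetric polynomial in the variables x_l for l in the i-th block of the thick strand occupying positions 2,…,m+1 (E_0 = 1). -/

import Mathlib

open Classical
open scoped BigOperators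

noncomputable section

/-- A Cartan datum on a finite index set `I`: a symmetric bilinear form with
`i·i ∈ 2ℤ_{>0}` and `2(i·j)/(i·i)` a nonpositive integer for `i ≠ j`. -/
structure CartanDatum (I : Type) [Fintype I] where
  form : I → I → ℤ
  symm : ∀ i j, form i j = form j i
  diag_even : ∀ i, Even (form i i)
  diag_pos : ∀ i, 0 < form i i
  off_dvd : ∀ i j, i ≠ j → form i i ∣ 2 * form i j
  off_nonpos : ∀ i j, i ≠ j → 2 * form i j ≤ 0

/-- The bilinear form of the extended Cartan datum on `Ĩ = I ⊔ Ī`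
(`Sum.inl` is `I`, `Sum.inr` is `Ī`). -/
def extForm {I : Type} [Fintype I] (C : CartanDatum I) : I ⊕ I → I ⊕ I → ℤ
  | Sum.inl i, Sum.inl j => C.form i j
  | Sum.inl i, Sum.inr j => if j = i then -(C.form i i / 2) else 0
  | Sum.inr i, Sum.inl j => if j = i then -(C.form i i / 2) else 0
  | Sum.inr i, Sum.inr j => if i = j then C.form i i else 0

/-- Generators of the KLR algebra on `n` strands labelled by `J`:
idempotents `e 𝐢`, dots `x j`, crossings `psi j` (crossing strands `j, j+1`, 0-indexed). -/
inductive KLRGen (J : Type) (n : ℕ) : Type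
  | e : (Fin n → J) → KLRGen J n
  | x : Fin n → KLRGen J n
  | psi : Fin (n - 1) → KLRGen J n

/-- The left strand position of the crossing `ψ_j`. -/
def lpos {n : ℕ} (j : Fin (n - 1)) : Fin n := Fin.castLE (n.sub_le 1) j

/-- The right strand position of the crossing `ψ_j`. -/
def rpos {n : ℕ} (j : Fin (n - 1)) : Fin n :=
  ⟨j.val + 1, by have := j.isLt; omega⟩

/-- The generator `e(𝐢)` of the free algebra. -/
def Ef (𝕜 : Type) [Field 𝕜] (J : Type) (n : ℕ) (i : Fin n → J) :
    FreeAlgebra 𝕜 (KLRGen J n) :=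
  FreeAlgebra.ι 𝕜 (KLRGen.e i)

/-- The generator `x_j` of the free algebra. -/
def Xf (𝕜 : Type) [Field 𝕜] (J : Type) (n : ℕ) (j : Fin n) :
    FreeAlgebra 𝕜 (KLRGen J n) :=
  FreeAlgebra.ι 𝕜 (KLRGen.x j)

/-- The generator `ψ_j` of the free algebra. -/
def Pf (𝕜 : Type) [Field 𝕜] (J : Type) (n : ℕ) (j : Fin (n - 1)) :
    FreeAlgebra 𝕜 (KLRGen J n) :=
  FreeAlgebra.ι 𝕜 (KLRGen.psi j)

/-- The Cartan integer `c(a,b) = 2(a·b)/(a·a)`. -/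
def cB {J : Type} (B : J → J → ℤ) (a b : J) : ℤ := 2 * B a b / B a a

/-- A bound such that any `p` with `s^{pq}(a,b) ≠ 0` satisfies `p < sBound B a b`. -/
def sBound {J : Type} (B : J → J → ℤ) (a b : J) : ℕ := (-(B a b)).toNat + 1

/-- The term `Σ_{p,q} s^{pq}(a,b) x_j^p x_{j'}^q`. -/
def psiSqS (𝕜 : Type) [Field 𝕜] (J : Type) (n : ℕ) (B : J → J → ℤ)
    (s : J → J → ℕ → ℕ → 𝕜) (a b : J) (j j' : Fin n) :
    FreeAlgebra 𝕜 (KLRGen J n) :=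
  ∑ p ∈ Finset.range (sBound B a b), ∑ q ∈ Finset.range (sBound B a b),
    s a b p q • (Xf 𝕜 J n j ^ p * Xf 𝕜 J n j' ^ q)

/-- The defining relations of the KLR algebra `R_n` associated with the form `B`
and scalar parameters `t`, `r`, `s`. -/
inductive KLRRel (𝕜 : Type) [Field 𝕜] (J : Type) [Fintype J] (n : ℕ)
    (B : J → J → ℤ) (t : J → J → 𝕜) (r : J → 𝕜) (s : J → J → ℕ → ℕ → 𝕜) :
    FreeAlgebra 𝕜 (KLRGen J n) → FreeAlgebra 𝕜 (KLRGen J n) → Prop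
  | ee (i j : Fin n → J) :
      KLRRel 𝕜 J n B t r s (Ef 𝕜 J n i * Ef 𝕜 J n j)
        (if i = j then Ef 𝕜 J n i else 0)
  | esum :
      KLRRel 𝕜 J n B t r s (∑ i : Fin n → J, Ef 𝕜 J n i) 1
  | xe (j : Fin n) (i : Fin n → J) :
      KLRRel 𝕜 J n B t r s (Xf 𝕜 J n j * Ef 𝕜 J n i) (Ef 𝕜 J n i * Xf 𝕜 J n j)
  | psie (j : Fin (n - 1)) (i : Fin n → J) :
      KLRRel 𝕜 J n B t r s (Pf 𝕜 J n j * Ef 𝕜 J n i)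
        (Ef 𝕜 J n (i ∘ Equiv.swap (lpos j) (rpos j)) * Pf 𝕜 J n j)
  | xx (j k : Fin n) :
      KLRRel 𝕜 J n B t r s (Xf 𝕜 J n j * Xf 𝕜 J n k) (Xf 𝕜 J n k * Xf 𝕜 J n j)
  | psix (j : Fin (n - 1)) (k : Fin n) (h1 : k ≠ lpos j) (h2 : k ≠ rpos j) :
      KLRRel 𝕜 J n B t r s (Pf 𝕜 J n j * Xf 𝕜 J n k) (Xf 𝕜 J n k * Pf 𝕜 J n j)
  | psipsi (j k : Fin (n - 1)) (h : (j : ℕ) + 1 < (k : ℕ)) :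
      KLRRel 𝕜 J n B t r s (Pf 𝕜 J n j * Pf 𝕜 J n k) (Pf 𝕜 J n k * Pf 𝕜 J n j)
  | dot1 (j : Fin (n - 1)) (i : Fin n → J) :
      KLRRel 𝕜 J n B t r s
        (Xf 𝕜 J n (lpos j) * Pf 𝕜 J n j * Ef 𝕜 J n i
          - Pf 𝕜 J n j * Xf 𝕜 J n (rpos j) * Ef 𝕜 J n i)
        (if i (lpos j) = i (rpos j) then r (i (lpos j)) • Ef 𝕜 J n i else 0)
  | dot2 (j : Fin (n - 1)) (i : Fin n → J) :
      KLRRel 𝕜 J n B t r s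
        (Pf 𝕜 J n j * Xf 𝕜 J n (lpos j) * Ef 𝕜 J n i
          - Xf 𝕜 J n (rpos j) * Pf 𝕜 J n j * Ef 𝕜 J n i)
        (if i (lpos j) = i (rpos j) then r (i (lpos j)) • Ef 𝕜 J n i else 0)
  | psisq (j : Fin (n - 1)) (i : Fin n → J) :
      KLRRel 𝕜 J n B t r s (Pf 𝕜 J n j * Pf 𝕜 J n j * Ef 𝕜 J n i)
        (if i (lpos j) = i (rpos j) then 0
         else if B (i (lpos j)) (i (rpos j)) = 0 then
           t (i (lpos j)) (i (rpos j)) • Ef 𝕜 J n i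
         else
           (t (i (lpos j)) (i (rpos j)) •
              (Xf 𝕜 J n (lpos j) ^ (-(cB B (i (lpos j)) (i (rpos j)))).toNat)
            + t (i (rpos j)) (i (lpos j)) •
              (Xf 𝕜 J n (rpos j) ^ (-(cB B (i (rpos j)) (i (lpos j)))).toNat)
            + psiSqS 𝕜 J n B s (i (lpos j)) (i (rpos j)) (lpos j) (rpos j))
           * Ef 𝕜 J n i)
  | braid (j k : Fin (n - 1)) (h : (j : ℕ) + 1 = (k : ℕ)) (i : Fin n → J) :
      KLRRel 𝕜 J n B t r s
        (Pf 𝕜 J n j * Pf 𝕜 J n k * Pf 𝕜 J n j * Ef 𝕜 J n i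
          - Pf 𝕜 J n k * Pf 𝕜 J n j * Pf 𝕜 J n k * Ef 𝕜 J n i)
        (if i (lpos j) = i (rpos k) ∧ cB B (i (lpos j)) (i (rpos j)) + 1 ≤ 0 then
          (r (i (lpos j)) * t (i (lpos j)) (i (rpos j))) •
            (∑ d ∈ Finset.range ((-(cB B (i (lpos j)) (i (rpos j))) - 1).toNat + 1),
              Xf 𝕜 J n (lpos j) ^ d
                * Xf 𝕜 J n (rpos k) ^ ((-(cB B (i (lpos j)) (i (rpos j))) - 1).toNat - d)
                * Ef 𝕜 J n i)
          + r (i (lpos j)) •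
            (∑ p ∈ Finset.range (sBound B (i (lpos j)) (i (rpos j))),
             ∑ q ∈ Finset.range (sBound B (i (lpos j)) (i (rpos j))),
              s (i (lpos j)) (i (rpos j)) p q •
                ∑ k1 ∈ Finset.range p,
                  Xf 𝕜 J n (lpos j) ^ k1 * Xf 𝕜 J n (rpos j) ^ q
                    * Xf 𝕜 J n (rpos k) ^ (p - 1 - k1) * Ef 𝕜 J n i)
         else 0)

/-- The KLR algebra `R_n` on `n` strands. -/
abbrev KLRAlg (𝕜 : Type) [Field 𝕜] (J : Type) [Fintype J] (n : ℕ)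
    (B : J → J → ℤ) (t : J → J → 𝕜) (r : J → 𝕜) (s : J → J → ℕ → ℕ → 𝕜) :=
  RingQuot (KLRRel 𝕜 J n B t r s)

/-- The canonical map from the free algebra to the KLR algebra. -/
def klrMk (𝕜 : Type) [Field 𝕜] (J : Type) [Fintype J] (n : ℕ)
    (B : J → J → ℤ) (t : J → J → 𝕜) (r : J → 𝕜) (s : J → J → ℕ → ℕ → 𝕜) :
    FreeAlgebra 𝕜 (KLRGen J n) →ₐ[𝕜] KLRAlg 𝕜 J n B t r s :=
  RingQuot.mkAlgHom 𝕜 (KLRRel 𝕜 J n B t r s)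

/-- The idempotent `e(𝐢)` in the KLR algebra. -/
def eQ (𝕜 : Type) [Field 𝕜] (J : Type) [Fintype J] (n : ℕ)
    (B : J → J → ℤ) (t : J → J → 𝕜) (r : J → 𝕜) (s : J → J → ℕ → ℕ → 𝕜)
    (i : Fin n → J) : KLRAlg 𝕜 J n B t r s :=
  klrMk 𝕜 J n B t r s (Ef 𝕜 J n i)

/-- The dot `x_j` in the KLR algebra. -/
def xQ (𝕜 : Type) [Field 𝕜] (J : Type) [Fintype J] (n : ℕ)
    (B : J → J → ℤ) (t : J → J → 𝕜) (r : J → 𝕜) (s : J → J → ℕ → ℕ → 𝕜)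
    (j : Fin n) : KLRAlg 𝕜 J n B t r s :=
  klrMk 𝕜 J n B t r s (Xf 𝕜 J n j)

/-- The crossing `ψ_j` in the KLR algebra. -/
def pQ (𝕜 : Type) [Field 𝕜] (J : Type) [Fintype J] (n : ℕ)
    (B : J → J → ℤ) (t : J → J → 𝕜) (r : J → 𝕜) (s : J → J → ℕ → ℕ → 𝕜)
    (j : Fin (n - 1)) : KLRAlg 𝕜 J n B t r s :=
  klrMk 𝕜 J n B t r s (Pf 𝕜 J n j)


section Extended

/-- The list of block labels of the thick strand: the label `i` appears with
multiplicity `λ^{(i)}`, in increasing order of `i`. -/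
def blockList (N : ℕ) (lam : Fin N → ℕ) : List (Fin N) :=
  (List.finRange N).flatMap (fun i => List.replicate (lam i) i)

/-- `m = Σ_i λ^{(i)}`, the total number of dashed strands of the thick strand. -/
def mTot (N : ℕ) (lam : Fin N → ℕ) : ℕ := (blockList N lam).length

/-- The block containing the strand position `l`. -/
def blockOf (N : ℕ) (lam : Fin N → ℕ) (l : Fin (mTot N lam)) : Fin N :=
  (blockList N lam).get l

/-- `psum i = Σ_{a < i} λ^{(a)}`, the starting position of the `i`-th block. -/
def psum (N : ℕ) (lam : Fin N → ℕ) (i : Fin N) : ℕ :=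
  ∑ a : Fin N, if a.val < i.val then lam a else 0

/-- The sequence `μ̄ ∈ Ī^m` listing each `ī` with multiplicity `λ^{(i)}`, in
increasing order of `i`. -/
def mubar (N : ℕ) (lam : Fin N → ℕ) : Fin (mTot N lam) → Fin N ⊕ Fin N :=
  fun l => Sum.inr (blockOf N lam l)

/-- The standard reduced word `s_1 (s_2 s_1) ⋯ (s_{a−1} ⋯ s_1)` (0-indexed) of the
longest element `w_0` of `𝔖_a`. -/
def w0Word (a : ℕ) : List ℕ :=
  (List.range a).flatMap (fun k => (List.range k).reverse)

/-- The KLR algebra `R_n(Q̄_{C̃})` of the extended Cartan datum of `C` with the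
specialized scalar parameters: `r ≡ 1`, `s ≡ 0` and `t` as given. -/
abbrev ExtKLR (𝕜 : Type) [Field 𝕜] (N : ℕ) (C : CartanDatum (Fin N))
    (t : Fin N ⊕ Fin N → Fin N ⊕ Fin N → 𝕜) (n : ℕ) :=
  KLRAlg 𝕜 (Fin N ⊕ Fin N) n (extForm C) t (fun _ => 1) (fun _ _ _ _ => 0)

/-- The dot `x_l` (0-indexed position `l`, junk value `1` if `l ≥ n`). -/
def Xn (𝕜 : Type) [Field 𝕜] (N : ℕ) (C : CartanDatum (Fin N))
    (t : Fin N ⊕ Fin N → Fin N ⊕ Fin N → 𝕜) (n : ℕ) (l : ℕ) :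
    ExtKLR 𝕜 N C t n :=
  if h : l < n then
    xQ 𝕜 (Fin N ⊕ Fin N) n (extForm C) t (fun _ => 1) (fun _ _ _ _ => 0) ⟨l, h⟩
  else 1

/-- The crossing `ψ_l` of the strands at 0-indexed positions `l, l+1`
(junk value `1` if `l ≥ n − 1`). -/
def Pn (𝕜 : Type) [Field 𝕜] (N : ℕ) (C : CartanDatum (Fin N))
    (t : Fin N ⊕ Fin N → Fin N ⊕ Fin N → 𝕜) (n : ℕ) (l : ℕ) :
    ExtKLR 𝕜 N C t n :=
  if h : l < n - 1 then
    pQ 𝕜 (Fin N ⊕ Fin N) n (extForm C) t (fun _ => 1) (fun _ _ _ _ => 0) ⟨l, h⟩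
  else 1

/-- The idempotent `e(𝐢)` of `R_n(Q̄_{C̃})`. -/
def eS (𝕜 : Type) [Field 𝕜] (N : ℕ) (C : CartanDatum (Fin N))
    (t : Fin N ⊕ Fin N → Fin N ⊕ Fin N → 𝕜) (n : ℕ)
    (i : Fin n → Fin N ⊕ Fin N) : ExtKLR 𝕜 N C t n :=
  eQ 𝕜 (Fin N ⊕ Fin N) n (extForm C) t (fun _ => 1) (fun _ _ _ _ => 0) i

/-- The nilHecke idempotent `e_a = x_1^{a−1} ⋯ x_{a−1} ψ_{w_0}` written in the
generators attached to the `a` consecutive strand positions `o, o+1, …, o+a−1`. -/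
def enAt (𝕜 : Type) [Field 𝕜] (N : ℕ) (C : CartanDatum (Fin N))
    (t : Fin N ⊕ Fin N → Fin N ⊕ Fin N → 𝕜) (n o a : ℕ) :
    ExtKLR 𝕜 N C t n :=
  (((List.range a).map (fun d => Xn 𝕜 N C t n (o + d) ^ (a - 1 - d))).prod) *
  (((w0Word a).map (fun l => Pn 𝕜 N C t n (o + l))).prod)

/-- The product `Π_{i ∈ I} e_{λ^{(i)}}` of nilHecke idempotents, the `i`-th one
written in the generators of the `i`-th block of strand positions, the thick
strand occupying the positions `o, o+1, …, o+m−1`. -/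
def nilProd (𝕜 : Type) [Field 𝕜] (N : ℕ) (C : CartanDatum (Fin N))
    (t : Fin N ⊕ Fin N → Fin N ⊕ Fin N → 𝕜) (lam : Fin N → ℕ) (n o : ℕ) :
    ExtKLR 𝕜 N C t n :=
  ((List.finRange N).map (fun i => enAt 𝕜 N C t n (o + psum N lam i) (lam i))).prod

/-- The thick idempotent `e_{λ} = e(μ̄) Π_i e_{λ^{(i)}} ∈ R_m(Q̄_{C̃})`. -/
def thickE (𝕜 : Type) [Field 𝕜] (N : ℕ) (C : CartanDatum (Fin N))
    (t : Fin N ⊕ Fin N → Fin N ⊕ Fin N → 𝕜) (lam : Fin N → ℕ) :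
    ExtKLR 𝕜 N C t (mTot N lam) :=
  eS 𝕜 N C t (mTot N lam) (mubar N lam) * nilProd 𝕜 N C t lam (mTot N lam) 0

/-- The `d`-th elementary symmetric polynomial in the dots `x_l`, `l ∈ S`. -/
def esymAt (𝕜 : Type) [Field 𝕜] (N : ℕ) (C : CartanDatum (Fin N))
    (t : Fin N ⊕ Fin N → Fin N ⊕ Fin N → 𝕜) (n d : ℕ) (S : Finset ℕ) :
    ExtKLR 𝕜 N C t n :=
  ∑ T ∈ S.powersetCard d, ((T.sort (· ≤ ·)).map (Xn 𝕜 N C t n)).prod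

/-- The set of strand positions of the `i`-th block of the thick strand, when the
thick strand occupies the positions `o, o+1, …, o+m−1`. -/
def blkSet (N : ℕ) (lam : Fin N → ℕ) (o : ℕ) (i : Fin N) : Finset ℕ :=
  Finset.Ico (o + psum N lam i) (o + psum N lam i + lam i)

end Extended


section OneSolid

variable (𝕜 : Type) [Field 𝕜] (N : ℕ) (C : CartanDatum (Fin N))
  (t : Fin N ⊕ Fin N → Fin N ⊕ Fin N → 𝕜) (lam : Fin N → ℕ)

/-- The idempotent `E_a = e((i,μ̄))·e_{λ_k}` of `R_{m+1}(Q̄_{C̃})`, the thick strand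
occupying positions `2,…,m+1` and the solid strand labelled `i` position `1`. -/
def Ea (i : Fin N) : ExtKLR 𝕜 N C t (mTot N lam + 1) :=
  eS 𝕜 N C t (mTot N lam + 1) (Fin.cons (Sum.inl i) (mubar N lam)) *
    nilProd 𝕜 N C t lam (mTot N lam + 1) 1

/-- The idempotent `E_b = e((μ̄,i))·e_{λ_k}` of `R_{m+1}(Q̄_{C̃})`, the thick strand
occupying positions `1,…,m` and the solid strand labelled `i` position `m+1`. -/
def Eb (i : Fin N) : ExtKLR 𝕜 N C t (mTot N lam + 1) :=
  eS 𝕜 N C t (mTot N lam + 1) (Fin.snoc (mubar N lam) (Sum.inl i)) *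
    nilProd 𝕜 N C t lam (mTot N lam + 1) 0

/-- The product of crossings `ψ_1 ψ_2 ⋯ ψ_m` in `R_{m+1}(Q̄_{C̃})`. -/
def psiUp : ExtKLR 𝕜 N C t (mTot N lam + 1) :=
  ((List.range (mTot N lam)).map (Pn 𝕜 N C t (mTot N lam + 1))).prod

/-- The product of crossings `ψ_m ψ_{m−1} ⋯ ψ_1` in `R_{m+1}(Q̄_{C̃})`. -/
def psiDown : ExtKLR 𝕜 N C t (mTot N lam + 1) :=
  ((List.range (mTot N lam)).reverse.map (Pn 𝕜 N C t (mTot N lam + 1))).prod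

end OneSolid

section BlockCombinatorics

variable {N : ℕ} (lam : Fin N → ℕ)

theorem length_flatMap_take_eq_psum (i : Fin N) :
    (((List.finRange N).take i.val).flatMap fun a => List.replicate (lam a) a).length
      = psum N lam i := by
  have hsum : psum N lam i
      = ((List.finRange N).map fun a => if a.val < i.val then lam a else 0).sum := by
    rw [psum, ← List.sum_ofFn, List.ofFn_eq_map]
  have hlo : ((List.finRange N).take i.val).map (fun a => if a.val < i.val then lam a else 0)
      = ((List.finRange N).take i.val).map lam := by
    refine List.map_congr_left fun a ha => if_pos ?_
    obtain ⟨k, hk, rfl⟩ := List.mem_iff_getElem.1 ha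
    simp at hk ⊢
    omega
  have hhi : (((List.finRange N).drop i.val).map
      fun a => if a.val < i.val then lam a else 0).sum = 0 := by
    refine List.sum_eq_zero fun x hx => ?_
    obtain ⟨a, ha, rfl⟩ := List.mem_map.1 hx
    obtain ⟨k, hk, rfl⟩ := List.mem_iff_getElem.1 ha
    simp
  rw [hsum, ← List.take_append_drop i.val (List.finRange N), List.map_append, List.sum_append,
    hhi, List.take_append_drop, hlo]
  simp [List.length_flatMap]

theorem blockList_eq_append (i : Fin N) :
    blockList N lam
      = (((List.finRange N).take i.val).flatMap fun a => List.replicate (lam a) a)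
        ++ (List.replicate (lam i) i
        ++ (((List.finRange N).drop (i.val + 1)).flatMap fun a => List.replicate (lam a) a)) := by
  have h : List.finRange N = (List.finRange N).take i.val
      ++ (i :: (List.finRange N).drop (i.val + 1)) := by
    conv_lhs => rw [← List.take_append_drop i.val (List.finRange N)]
    rw [List.drop_eq_getElem_cons (by simp)]
    simp
  rw [blockList]
  conv_lhs => rw [h]
  rw [List.flatMap_append, List.flatMap_cons]

theorem blockOf_eq_iff (i : Fin N) (l : Fin (mTot N lam)) :
    blockOf N lam l = i ↔ psum N lam i ≤ l.val ∧ l.val < psum N lam i + lam i := by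
  have key : ∀ (A B : List (Fin N)) (k : ℕ), i ∉ A → i ∉ B →
      ((A ++ (List.replicate (lam i) i ++ B))[k]? = some i
        ↔ A.length ≤ k ∧ k < A.length + lam i) := by
    intro A B k hA hB
    rw [List.getElem?_append]
    split_ifs with h1
    · refine iff_of_false (fun h => hA (List.mem_of_getElem? h)) (by omega)
    · rw [List.getElem?_append, List.length_replicate]
      split_ifs with h2
      · refine iff_of_true ?_ (by omega)
        simp [h2]
      · refine iff_of_false (fun h => hB (List.mem_of_getElem? h)) (by omega)
  have hA : i ∉ ((List.finRange N).take i.val).flatMap fun a => List.replicate (lam a) a := by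
    intro h
    obtain ⟨a, ha, hi⟩ := List.mem_flatMap.1 h
    obtain rfl := (List.mem_replicate.1 hi).2
    obtain ⟨k, hk, hki⟩ := List.mem_iff_getElem.1 ha
    have := congrArg Fin.val hki
    simp at hk this
    omega
  have hB : i ∉ ((List.finRange N).drop (i.val + 1)).flatMap
      fun a => List.replicate (lam a) a := by
    intro h
    obtain ⟨a, ha, hi⟩ := List.mem_flatMap.1 h
    obtain rfl := (List.mem_replicate.1 hi).2
    obtain ⟨k, hk, hki⟩ := List.mem_iff_getElem.1 ha
    have := congrArg Fin.val hki
    simp at this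
    omega
  rw [← length_flatMap_take_eq_psum, ← key _ _ _ hA hB, ← blockList_eq_append, blockOf,
    List.getElem?_eq_getElem l.isLt, Option.some_inj]
  rfl

theorem psum_add_le_mTot (i : Fin N) : psum N lam i + lam i ≤ mTot N lam := by
  rw [mTot, blockList_eq_append lam i, ← length_flatMap_take_eq_psum]
  simp

end BlockCombinatorics

open scoped IsMulCommutative in
theorem exists_commRing_hom_of_commute {A : Type} [Ring A] (X : ℕ → A)
    (hX : ∀ a b, Commute (X a) (X b)) :
    ∃ (B : Type) (_ : CommRing B) (φ : B →+* A) (Y : ℕ → B), ∀ l, φ (Y l) = X l :=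
  have : IsMulCommutative (Subring.closure (Set.range X)) :=
    Subring.isMulCommutative_closure (by rintro _ ⟨a, rfl⟩ _ ⟨b, rfl⟩; exact hX a b)
  ⟨Subring.closure (Set.range X), inferInstance,
    (Subring.closure (Set.range X)).subtype,
    fun l => ⟨X l, Subring.subset_closure ⟨l, rfl⟩⟩, fun _ => rfl⟩

theorem neg_one_pow_smul {𝕜 A : Type} [Field 𝕜] [Ring A] [Algebra 𝕜 A] (d : ℕ) (z : A) :
    (-1 : 𝕜) ^ d • z = (-1) ^ d * z := by
  rw [Algebra.smul_def, map_pow, map_neg, map_one]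

theorem prod_sub_eq_sum_powersetCard {B : Type} [CommRing B] (y : B) (Y : ℕ → B)
    (S : Finset ℕ) :
    ∏ l ∈ S, (y - Y l)
      = ∑ d ∈ Finset.range (S.card + 1),
          (-1) ^ d * (y ^ (S.card - d) * ∑ T ∈ S.powersetCard d, ∏ l ∈ T, Y l) := by
  have h : ∀ l, y - Y l = -Y l + y := fun l => by ring
  simp_rw [h, Finset.prod_add, Finset.sum_powerset, Finset.mul_sum]
  refine Finset.sum_congr rfl fun d _ => Finset.sum_congr rfl fun T hT => ?_
  obtain ⟨hTS, rfl⟩ := Finset.mem_powersetCard.1 hT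
  rw [Finset.prod_const, Finset.card_sdiff_of_subset hTS, Finset.prod_neg]
  ring

section Relations

variable (𝕜 : Type) [Field 𝕜] (N : ℕ) (C : CartanDatum (Fin N))
  (t : Fin N ⊕ Fin N → Fin N ⊕ Fin N → 𝕜) {n : ℕ}

theorem klrMk_eq {J : Type} [Fintype J] {B : J → J → ℤ} {t : J → J → 𝕜} {r : J → 𝕜}
    {s : J → J → ℕ → ℕ → 𝕜} {a b : FreeAlgebra 𝕜 (KLRGen J n)}
    (h : KLRRel 𝕜 J n B t r s a b) : klrMk 𝕜 J n B t r s a = klrMk 𝕜 J n B t r s b :=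
  RingQuot.mkAlgHom_rel 𝕜 h

theorem Xn_commute (k l : ℕ) : Commute (Xn 𝕜 N C t n k) (Xn 𝕜 N C t n l) := by
  unfold Xn
  split_ifs with h1 h2
  · have h := klrMk_eq 𝕜 (KLRRel.xx (B := extForm C) (t := t) (r := fun _ => 1)
      (s := fun _ _ _ _ => 0) ⟨k, h1⟩ ⟨l, h2⟩)
    simp only [map_mul] at h
    exact h
  all_goals first | exact Commute.one_right _ | exact Commute.one_left _

theorem Xn_commute_eS (k : ℕ) (s : Fin n → Fin N ⊕ Fin N) :
    Commute (Xn 𝕜 N C t n k) (eS 𝕜 N C t n s) := by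
  unfold Xn
  split_ifs with h1
  · have h := klrMk_eq 𝕜 (KLRRel.xe (B := extForm C) (t := t) (r := fun _ => 1)
      (s := fun _ _ _ _ => 0) ⟨k, h1⟩ s)
    simp only [map_mul] at h
    exact h
  · exact Commute.one_left _

theorem Pn_commute_Xn (l k : ℕ) (h1 : k ≠ l) (h2 : k ≠ l + 1) :
    Commute (Pn 𝕜 N C t n l) (Xn 𝕜 N C t n k) := by
  unfold Xn Pn
  split_ifs with h3 h4
  · have h := klrMk_eq 𝕜 (KLRRel.psix (B := extForm C) (t := t) (r := fun _ => 1)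
      (s := fun _ _ _ _ => 0) ⟨l, h3⟩ ⟨k, h4⟩ (fun h => h1 (congrArg Fin.val h))
      (fun h => h2 (congrArg Fin.val h)))
    simp only [map_mul] at h
    exact h
  all_goals first | exact Commute.one_right _ | exact Commute.one_left _

theorem Pn_mul_eS (l : Fin n) (s : Fin (n + 1) → Fin N ⊕ Fin N) :
    Pn 𝕜 N C t (n + 1) l * eS 𝕜 N C t (n + 1) s
      = eS 𝕜 N C t (n + 1) (s ∘ Equiv.swap l.castSucc l.succ) * Pn 𝕜 N C t (n + 1) l := by
  have h := klrMk_eq 𝕜 (KLRRel.psie (n := n + 1) (B := extForm C) (t := t) (r := fun _ => 1)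
    (s := fun _ _ _ _ => 0) l s)
  simp only [map_mul] at h
  rw [Pn, dif_pos (by simp)]
  exact h

theorem Pn_mul_Xn_mul_eS (l : Fin n) (s : Fin (n + 1) → Fin N ⊕ Fin N)
    (hs : s l.castSucc ≠ s l.succ) :
    Xn 𝕜 N C t (n + 1) (l + 1) * Pn 𝕜 N C t (n + 1) l * eS 𝕜 N C t (n + 1) s
      = Pn 𝕜 N C t (n + 1) l * Xn 𝕜 N C t (n + 1) l * eS 𝕜 N C t (n + 1) s := by
  have h := klrMk_eq 𝕜 (KLRRel.dot2 (n := n + 1) (B := extForm C) (t := t) (r := fun _ => 1)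
    (s := fun _ _ _ _ => 0) l s)
  rw [if_neg (show ¬ s (lpos (n := n + 1) l) = s (rpos (n := n + 1) l) from hs), map_sub,
    map_zero, sub_eq_zero] at h
  simp only [map_mul] at h
  rw [Pn, dif_pos (by simp), Xn, dif_pos (by omega), Xn, dif_pos (by omega)]
  exact h.symm

theorem cB_extForm_inl_inr (i : Fin N) :
    cB (extForm C) (Sum.inl i) (Sum.inr i) = -1 := by
  obtain ⟨c, hc⟩ := C.diag_even i
  have := C.diag_pos i
  rw [cB, extForm, extForm, if_pos rfl, show 2 * -(C.form i i / 2) = -C.form i i by omega]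
  exact Int.neg_ediv_self _ (by omega)

theorem cB_extForm_inr_inl (i : Fin N) :
    cB (extForm C) (Sum.inr i) (Sum.inl i) = -1 := by
  obtain ⟨c, hc⟩ := C.diag_even i
  have := C.diag_pos i
  rw [cB, extForm, extForm, if_pos rfl, if_pos rfl,
    show 2 * -(C.form i i / 2) = -C.form i i by omega]
  exact Int.neg_ediv_self _ (by omega)

theorem Pn_sq_mul_eS
    (ht1 : ∀ k : Fin N, t (Sum.inr k) (Sum.inl k) = -1)
    (ht2 : ∀ k : Fin N, t (Sum.inl k) (Sum.inr k) = 1)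
    (ht3 : ∀ a b, extForm C a b = 0 → t a b = 1)
    (l : Fin n) (s : Fin (n + 1) → Fin N ⊕ Fin N) (i j : Fin N)
    (hi : s l.castSucc = Sum.inl i) (hj : s l.succ = Sum.inr j) :
    Pn 𝕜 N C t (n + 1) l * Pn 𝕜 N C t (n + 1) l * eS 𝕜 N C t (n + 1) s
      = (if j = i then Xn 𝕜 N C t (n + 1) l - Xn 𝕜 N C t (n + 1) (l + 1) else 1)
        * eS 𝕜 N C t (n + 1) s := by
  have h := klrMk_eq 𝕜 (KLRRel.psisq (n := n + 1) (B := extForm C) (t := t) (r := fun _ => 1)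
    (s := fun _ _ _ _ => 0) l s)
  rw [show s (lpos (n := n + 1) l) = Sum.inl i from hi,
    show s (rpos (n := n + 1) l) = Sum.inr j from hj, if_neg (by simp)] at h
  rw [Pn, dif_pos (by simp), Xn, dif_pos (by omega), Xn, dif_pos (by omega)]
  simp only [map_mul] at h
  refine h.trans ?_
  by_cases hij : j = i
  · subst hij
    have := C.diag_pos j
    obtain ⟨c, hc⟩ := C.diag_even j
    rw [if_neg (by simp only [extForm, if_true]; omega), if_pos rfl, cB_extForm_inl_inr,
      cB_extForm_inr_inl, ht1, ht2]
    simp only [psiSqS, zero_smul, Finset.sum_const_zero, add_zero, map_mul, map_sub,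
      neg_neg, Int.toNat_one, pow_one, one_smul, neg_smul, ← sub_eq_add_neg]
    rfl
  · have h0 : extForm C (Sum.inl i) (Sum.inr j) = 0 := by simp [extForm, hij]
    rw [if_pos h0, if_neg hij, ht3 _ _ h0, one_smul, one_mul]
    rfl

/-- The label sequence obtained from `s` by moving its first entry right by `k` places. -/
def shiftSeq {J : Type} (s : Fin (n + 1) → J) : ℕ → Fin (n + 1) → J
  | 0 => s
  | k + 1 => if h : k < n then
      shiftSeq s k ∘ Equiv.swap (Fin.castSucc ⟨k, h⟩) (Fin.succ ⟨k, h⟩) else shiftSeq s k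

theorem shiftSeq_apply_of_lt {J : Type} (s : Fin (n + 1) → J) (k : ℕ) (p : Fin (n + 1))
    (hp : k < p.val) : shiftSeq s k p = s p := by
  induction k with
  | zero => rfl
  | succ k ih =>
    have hk : k < n := by omega
    rw [shiftSeq, dif_pos hk, Function.comp_apply, Equiv.swap_apply_of_ne_of_ne, ih (by omega)]
    · rintro rfl; simp at hp
    · rintro rfl; simp at hp

theorem shiftSeq_apply_self {J : Type} (s : Fin (n + 1) → J) (k : ℕ) (hk : k < n + 1) :
    shiftSeq s k ⟨k, hk⟩ = s 0 := by
  induction k with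
  | zero => rfl
  | succ k ih =>
    have hk' : k < n := by omega
    rw [shiftSeq, dif_pos hk', Function.comp_apply]
    exact (congrArg _ (Equiv.swap_apply_right _ _)).trans (ih (by omega))

/-- The product of crossings `ψ_k ⋯ ψ_1`. -/
def psiDesc (n k : ℕ) : ExtKLR 𝕜 N C t n :=
  ((List.range k).reverse.map (Pn 𝕜 N C t n)).prod

theorem psiDesc_succ (k : ℕ) :
    psiDesc 𝕜 N C t n (k + 1) = Pn 𝕜 N C t n k * psiDesc 𝕜 N C t n k := by
  simp [psiDesc, List.range_succ]

theorem psiDesc_mul_eS (s : Fin (n + 1) → Fin N ⊕ Fin N) {k : ℕ} (hk : k ≤ n) :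
    psiDesc 𝕜 N C t (n + 1) k * eS 𝕜 N C t (n + 1) s
      = eS 𝕜 N C t (n + 1) (shiftSeq s k) * psiDesc 𝕜 N C t (n + 1) k := by
  induction k with
  | zero => simp [psiDesc, shiftSeq]
  | succ k ih =>
    rw [psiDesc_succ, mul_assoc, ih (by omega), ← mul_assoc,
      Pn_mul_eS 𝕜 N C t ⟨k, hk⟩, shiftSeq, dif_pos (Nat.lt_of_succ_le hk), mul_assoc]

theorem psiDesc_commute_Xn {k l : ℕ} (hkl : k < l) :
    Commute (psiDesc 𝕜 N C t n k) (Xn 𝕜 N C t n l) := by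
  induction k with
  | zero => exact (by simp [psiDesc] : psiDesc 𝕜 N C t n 0 = 1) ▸ Commute.one_left _
  | succ k ih =>
    rw [psiDesc_succ]
    exact (Pn_commute_Xn 𝕜 N C t k l (by omega) (by omega)).mul_left (ih (by omega))

variable (i : Fin N) (b : Fin n → Fin N)

theorem shiftSeq_cons_castSucc (k : Fin n) :
    shiftSeq (Fin.cons (Sum.inl i) fun l => Sum.inr (b l) : Fin (n + 1) → Fin N ⊕ Fin N) k
      k.castSucc = Sum.inl i :=
  shiftSeq_apply_self _ _ _

theorem shiftSeq_cons_succ (k : Fin n) :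
    shiftSeq (Fin.cons (Sum.inl i) fun l => Sum.inr (b l) : Fin (n + 1) → Fin N ⊕ Fin N) k
      k.succ = Sum.inr (b k) := by
  rw [shiftSeq_apply_of_lt _ _ _ (by simp), Fin.cons_succ]

theorem Xn_mul_psiDesc_mul_eS {k : ℕ} (hk : k ≤ n) :
    Xn 𝕜 N C t (n + 1) k * psiDesc 𝕜 N C t (n + 1) k
        * eS 𝕜 N C t (n + 1) (Fin.cons (Sum.inl i) fun l => Sum.inr (b l))
      = psiDesc 𝕜 N C t (n + 1) k * Xn 𝕜 N C t (n + 1) 0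
        * eS 𝕜 N C t (n + 1) (Fin.cons (Sum.inl i) fun l => Sum.inr (b l)) := by
  induction k with
  | zero => simp [psiDesc]
  | succ k ih =>
    have hx := Pn_mul_Xn_mul_eS 𝕜 N C t ⟨k, hk⟩
      (shiftSeq (Fin.cons (Sum.inl i) fun l => Sum.inr (b l)) k)
      (by rw [shiftSeq_cons_castSucc N i b ⟨k, hk⟩, shiftSeq_cons_succ N i b ⟨k, hk⟩]; simp)
    simp only at hx
    rw [psiDesc_succ, ← mul_assoc, mul_assoc _ (psiDesc _ _ _ _ _ _),
      psiDesc_mul_eS 𝕜 N C t _ (by omega), ← mul_assoc, hx, mul_assoc _ (eS _ _ _ _ _ _),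
      ← psiDesc_mul_eS 𝕜 N C t _ (by omega)]
    simp only [mul_assoc] at ih ⊢
    rw [ih (by omega)]

/-- The factor contributed by pulling a solid strand `i` around the `l`-th dashed strand. -/
def crossFactor (l : ℕ) : ExtKLR 𝕜 N C t (n + 1) :=
  if ∃ h : l < n, b ⟨l, h⟩ = i then Xn 𝕜 N C t (n + 1) 0 - Xn 𝕜 N C t (n + 1) (l + 1) else 1

theorem crossFactor_commute_eS (l : ℕ) (s : Fin (n + 1) → Fin N ⊕ Fin N) :
    Commute (crossFactor 𝕜 N C t i b l) (eS 𝕜 N C t (n + 1) s) := by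
  unfold crossFactor
  split_ifs
  · exact (Xn_commute_eS 𝕜 N C t _ _).sub_left (Xn_commute_eS 𝕜 N C t _ _)
  · exact Commute.one_left _

theorem Pn_sq_mul_psiDesc_mul_eS
    (ht1 : ∀ k : Fin N, t (Sum.inr k) (Sum.inl k) = -1)
    (ht2 : ∀ k : Fin N, t (Sum.inl k) (Sum.inr k) = 1)
    (ht3 : ∀ a b, extForm C a b = 0 → t a b = 1) {k : ℕ} (hk : k < n) :
    Pn 𝕜 N C t (n + 1) k * Pn 𝕜 N C t (n + 1) k * psiDesc 𝕜 N C t (n + 1) k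
        * eS 𝕜 N C t (n + 1) (Fin.cons (Sum.inl i) fun l => Sum.inr (b l))
      = psiDesc 𝕜 N C t (n + 1) k * crossFactor 𝕜 N C t i b k
        * eS 𝕜 N C t (n + 1) (Fin.cons (Sum.inl i) fun l => Sum.inr (b l)) := by
  have hsq := Pn_sq_mul_eS 𝕜 N C t ht1 ht2 ht3 ⟨k, hk⟩ _ i (b ⟨k, hk⟩)
    (shiftSeq_cons_castSucc N i b ⟨k, hk⟩) (shiftSeq_cons_succ N i b ⟨k, hk⟩)
  simp only at hsq
  rw [mul_assoc _ (psiDesc _ _ _ _ _ _), psiDesc_mul_eS 𝕜 N C t _ hk.le, ← mul_assoc, hsq,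
    mul_assoc, ← psiDesc_mul_eS 𝕜 N C t _ hk.le, crossFactor]
  by_cases hb : b ⟨k, hk⟩ = i
  · rw [if_pos hb, if_pos ⟨hk, hb⟩, sub_mul, mul_sub, sub_mul, ← mul_assoc, ← mul_assoc,
      Xn_mul_psiDesc_mul_eS 𝕜 N C t i b hk.le,
      (psiDesc_commute_Xn 𝕜 N C t (Nat.lt_succ_self k)).eq]
  · rw [if_neg hb, if_neg fun ⟨_, h⟩ => hb h, one_mul, mul_one]

theorem psi_up_down_mul_eS
    (ht1 : ∀ k : Fin N, t (Sum.inr k) (Sum.inl k) = -1)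
    (ht2 : ∀ k : Fin N, t (Sum.inl k) (Sum.inr k) = 1)
    (ht3 : ∀ a b, extForm C a b = 0 → t a b = 1) {k : ℕ} (hk : k ≤ n) :
    ((List.range k).map (Pn 𝕜 N C t (n + 1))).prod * psiDesc 𝕜 N C t (n + 1) k
        * eS 𝕜 N C t (n + 1) (Fin.cons (Sum.inl i) fun l => Sum.inr (b l))
      = ((List.range k).map (crossFactor 𝕜 N C t i b)).prod
        * eS 𝕜 N C t (n + 1) (Fin.cons (Sum.inl i) fun l => Sum.inr (b l)) := by
  induction k with
  | zero => simp [psiDesc]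
  | succ k ih =>
    have hsq := Pn_sq_mul_psiDesc_mul_eS 𝕜 N C t i b ht1 ht2 ht3 hk
    simp only [mul_assoc] at hsq ih
    simp only [psiDesc_succ, List.range_succ, List.map_append, List.prod_append, List.map_cons,
      List.map_nil, List.prod_cons, List.prod_nil, mul_one, mul_assoc]
    rw [hsq, (crossFactor_commute_eS 𝕜 N C t i b k _).eq, ← mul_assoc (psiDesc _ _ _ _ _ _),
      ← mul_assoc, ih (by omega), mul_assoc]

theorem prod_crossFactor_eq_sum_esymAt (lam : Fin N → ℕ) :
    ((List.range (mTot N lam)).map (crossFactor 𝕜 N C t i (blockOf N lam))).prod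
      = ∑ d ∈ Finset.range (lam i + 1), ((-1 : 𝕜) ^ d) •
          (Xn 𝕜 N C t (mTot N lam + 1) 0 ^ (lam i - d)
            * esymAt 𝕜 N C t (mTot N lam + 1) d (blkSet N lam 1 i)) := by
  obtain ⟨B, _, φ, Y, hY⟩ := exists_commRing_hom_of_commute _
    (Xn_commute 𝕜 N C t (n := mTot N lam + 1))
  have hfac : crossFactor 𝕜 N C t i (blockOf N lam)
      = fun l => φ (if l + 1 ∈ blkSet N lam 1 i then Y 0 - Y (l + 1) else 1) := by
    funext l
    have hiff : (∃ h : l < mTot N lam, blockOf N lam ⟨l, h⟩ = i) ↔ l + 1 ∈ blkSet N lam 1 i := by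
      have := psum_add_le_mTot lam i
      simp only [blockOf_eq_iff, blkSet, Finset.mem_Ico, exists_prop]
      omega
    rw [crossFactor, if_congr hiff rfl rfl]
    split_ifs
    · rw [map_sub, hY, hY]
    · rw [map_one]
  have hprod : ∏ l ∈ Finset.range (mTot N lam),
      (if l + 1 ∈ blkSet N lam 1 i then Y 0 - Y (l + 1) else 1)
        = ∏ l ∈ blkSet N lam 1 i, (Y 0 - Y l) := by
    have hle := psum_add_le_mTot lam i
    rw [← Finset.prod_filter]
    refine Finset.prod_bij (fun l _ => l + 1) (fun l hl => (Finset.mem_filter.1 hl).2)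
      (fun _ _ _ _ h => Nat.succ_injective h) (fun l hl => ?_) (fun _ _ => rfl)
    have hl' := hl
    rw [blkSet, Finset.mem_Ico] at hl'
    have hl1 : l - 1 + 1 = l := by omega
    exact ⟨l - 1, Finset.mem_filter.2 ⟨Finset.mem_range.2 (by omega), hl1 ▸ hl⟩, hl1⟩
  have hesym : ∀ d, esymAt 𝕜 N C t (mTot N lam + 1) d (blkSet N lam 1 i)
      = φ (∑ T ∈ (blkSet N lam 1 i).powersetCard d, ∏ l ∈ T, Y l) := by
    intro d
    rw [esymAt, map_sum]
    refine Finset.sum_congr rfl fun T _ => ?_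
    have hT : ∏ l ∈ T, Y l = ((T.sort (· ≤ ·)).map Y).prod := by
      rw [← Finset.prod_map_toList]
      exact ((Finset.sort_perm_toList _ _).map _).prod_eq.symm
    rw [hT, map_list_prod, List.map_map]
    exact congrArg List.prod (List.map_congr_left fun l _ => (hY l).symm)
  have hcard : (blkSet N lam 1 i).card = lam i := by simp [blkSet]
  have hlist : ((List.range (mTot N lam)).map fun l =>
      φ (if l + 1 ∈ blkSet N lam 1 i then Y 0 - Y (l + 1) else 1)).prod
        = φ (∏ l ∈ Finset.range (mTot N lam),
            (if l + 1 ∈ blkSet N lam 1 i then Y 0 - Y (l + 1) else 1)) := by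
    rw [← List.toFinset_range, List.prod_toFinset _ List.nodup_range, map_list_prod, List.map_map]
    rfl
  rw [hfac, hlist, hprod, prod_sub_eq_sum_powersetCard, hcard, map_sum]
  refine Finset.sum_congr rfl fun d _ => ?_
  rw [hesym, ← hY 0]
  simp only [map_mul, map_pow, map_neg, map_one]
  exact (neg_one_pow_smul d _).symm

end Relations

/-- double crossing of a solid strand around the thick strand,
solid strand on the left:
`(ψ_1⋯ψ_m)(ψ_m⋯ψ_1) E_a = Σ_{d_1+d_2=λ_k^{(i)}} (−1)^{d_2} x_1^{d_1} E_{d_2}^{(i)}[2,…,m+1] E_a`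
in `R_{m+1}(Q̄_{C̃})`. -/
theorem double_crossing_solid_left
    (𝕜 : Type) [Field 𝕜] (N : ℕ) (C : CartanDatum (Fin N))
    (t : Fin N ⊕ Fin N → Fin N ⊕ Fin N → 𝕜)
    (ht0 : ∀ a b, t a b ≠ 0)
    (ht1 : ∀ k : Fin N, t (Sum.inr k) (Sum.inl k) = -1)
    (ht2 : ∀ k : Fin N, t (Sum.inl k) (Sum.inr k) = 1)
    (ht3 : ∀ a b, extForm C a b = 0 → t a b = 1)
    (ht4 : ∀ a, t a a = 1)
    (lam : Fin N → ℕ) (i : Fin N) :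
    psiUp 𝕜 N C t lam * psiDown 𝕜 N C t lam * Ea 𝕜 N C t lam i
      = ∑ d2 ∈ Finset.range (lam i + 1),
          ((-1 : 𝕜) ^ d2) •
            (Xn 𝕜 N C t (mTot N lam + 1) 0 ^ (lam i - d2)
              * esymAt 𝕜 N C t (mTot N lam + 1) d2 (blkSet N lam 1 i)
              * Ea 𝕜 N C t lam i) := by
  have h := psi_up_down_mul_eS 𝕜 N C t i (blockOf N lam) ht1 ht2 ht3 le_rfl
  calc psiUp 𝕜 N C t lam * psiDown 𝕜 N C t lam * Ea 𝕜 N C t lam i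
      = ((List.range (mTot N lam)).map (crossFactor 𝕜 N C t i (blockOf N lam))).prod
          * Ea 𝕜 N C t lam i := by
        rw [Ea, ← mul_assoc, ← mul_assoc]
        exact congrArg (· * _) h
    _ = _ := by
        rw [prod_crossFactor_eq_sum_esymAt, Finset.sum_mul]
        simp only [smul_mul_assoc]

end
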